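/- Let K ∈ M_+(ℝ_+×ℝ_+) and set L(t,s) = (K^{*₂})^{*₁}(t,s), its iterated rearrangement. Let Φ₁, Φ₂ be N-functions and u₁, u₂ weights, and suppose Φ₁ and u₁ satisfy the two conditions of the Hardy-averaging theorem: there is c > 0, independent of λ, x, with φ₁( c α(λ,x)/λ ) U₁(x) ≤ c^{-1} λ where α(λ,x) = ∫_x^∞ Φ₁(λ/U₁(y)) u₁(y) dy and U₁(x) = ∫_0^x u₁, and ∫_0^x φ₁^{-1}( (c β(λ,x)/λ)(y/U₁(y)) ) (y u₁(y)/U₁(y)) dy ≤ c^{-1} λ where β(λ,x) = ∫_x^∞ Φ₁(λ/y) u₁(y) dy. Then, if ρ_{Φ₁,u₁}(T_L f*) ≤ C ρ_{Φ₂,u₂}(f*) for all f ∈ M_+(ℝ_+), it follows that ρ_{Φ₁,u₁}((T_K f)*) ≤ C' ρ_{Φ₂,u₂}(f*) for all f ∈ M_+(ℝ_+), with C' independent of f. -/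

import Mathlib

open MeasureTheory Set
open scoped ENNReal

noncomputable section

/-- The positive integral operator `T_K` on `ℝ₊`. -/
def TK (K : ℝ → ℝ → ℝ≥0∞) (f : ℝ → ℝ≥0∞) (x : ℝ) : ℝ≥0∞ :=
  ∫⁻ y in Ioi (0:ℝ), K x y * f y

/-- Distribution function `μ_f(λ) = |{x ∈ ℝ₊ : f x > λ}|`. -/
def distrib (f : ℝ → ℝ≥0∞) (l : ℝ≥0∞) : ℝ≥0∞ :=
  volume {x : ℝ | 0 < x ∧ l < f x}

/-- Nonincreasing rearrangement `f*(t) = inf{λ : μ_f(λ) ≤ t}`. -/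
def rearr (f : ℝ → ℝ≥0∞) (t : ℝ) : ℝ≥0∞ :=
  sInf {l : ℝ≥0∞ | distrib f l ≤ ENNReal.ofReal t}

/-- Extension of a real function to `ℝ≥0∞`. -/
def extE (F : ℝ → ℝ) (a : ℝ≥0∞) : ℝ≥0∞ :=
  if a = ⊤ then ⊤ else ENNReal.ofReal (F a.toReal)

/-- Orlicz–Lorentz gauge functional `ρ_{Φ,u}`. -/
def ogauge (F : ℝ → ℝ) (u : ℝ → ℝ) (f : ℝ → ℝ≥0∞) : ℝ≥0∞ :=
  sInf {l : ℝ≥0∞ | 0 < l ∧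
    (∫⁻ x in Ioi (0:ℝ), extE F (f x / l) * ENNReal.ofReal (u x)) ≤ 1}

/-- `F` is an N-function with density `φ`: `F x = ∫_0^x φ`, `φ` increasing from `ℝ₊` onto `ℝ₊`. -/
def IsNFunction (F φ : ℝ → ℝ) : Prop :=
  StrictMonoOn φ (Ioi 0) ∧ MapsTo φ (Ioi 0) (Ioi 0) ∧ SurjOn φ (Ioi 0) (Ioi 0) ∧
    ∀ x : ℝ, 0 ≤ x → F x = ∫ y in (0:ℝ)..x, φ y

/-- `F(2t) ≈ F(t)` on `ℝ₊`. -/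
def Doubling (F : ℝ → ℝ) : Prop := ∃ C > 0, ∀ t > 0, F (2 * t) ≤ C * F t

/-- A weight: nonnegative, measurable, locally integrable on `ℝ₊`. -/
def IsWeight (u : ℝ → ℝ) : Prop :=
  Measurable u ∧ (∀ x, 0 ≤ u x) ∧ LocallyIntegrableOn u (Ioi 0)

/-- `U(x) = ∫_0^x u`. -/
def Uw (u : ℝ → ℝ) (x : ℝ) : ℝ := ∫ t in (0:ℝ)..x, u t

/-- `Ψ` (with density `ψ`) is the complementary N-function of the N-function `Φ`
(with density `φ`), i.e. `ψ = φ⁻¹` and `Ψ t = ∫_0^t φ⁻¹`. -/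
def IsComplementary (F φ G ψ : ℝ → ℝ) : Prop :=
  IsNFunction F φ ∧ IsNFunction G ψ ∧ InvOn ψ φ (Ioi 0) (Ioi 0)

/-- `g` is the inverse of `f` on `[0,∞)`. -/
def IsInverseOn (g f : ℝ → ℝ) : Prop :=
  (∀ x ≥ 0, g (f x) = x) ∧ (∀ y ≥ 0, f (g y) = y)

/-- Iterated rearrangement `L(t,s) = (K^{*₂})^{*₁}(t,s)`. -/
def iterRearr (K : ℝ → ℝ → ℝ≥0∞) (t s : ℝ) : ℝ≥0∞ :=
  rearr (fun x => rearr (fun y => K x y) s) t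

/-- `α(λ,x) = ∫_x^∞ Φ(λ/U(y)) u(y) dy`. -/
def hardyAlpha (F : ℝ → ℝ) (u : ℝ → ℝ) (lam x : ℝ) : ℝ≥0∞ :=
  ∫⁻ y in Ioi x, extE F (ENNReal.ofReal lam / ENNReal.ofReal (Uw u y)) * ENNReal.ofReal (u y)

/-- `β(λ,x) = ∫_x^∞ Φ(λ/y) u(y) dy`. -/
def hardyBeta (F : ℝ → ℝ) (u : ℝ → ℝ) (lam x : ℝ) : ℝ≥0∞ :=
  ∫⁻ y in Ioi x, ENNReal.ofReal (F (lam / y)) * ENNReal.ofReal (u y)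

/-- The Hardy-averaging conditions (14)–(15) for an N-function `Φ` (density `φ`,
inverse density `ψ = φ⁻¹`) and weight `u`. -/
def HardyConditions (F φ ψ u : ℝ → ℝ) : Prop :=
  ∃ c > 0, (∀ lam > 0, ∀ x > 0,
      extE φ (ENNReal.ofReal c * hardyAlpha F u lam x / ENNReal.ofReal lam) *
        ENNReal.ofReal (Uw u x) ≤ ENNReal.ofReal (lam / c)) ∧
    (∀ lam > 0, ∀ x > 0,
      (∫⁻ y in Ioo (0:ℝ) x,
        extE ψ ((ENNReal.ofReal c * hardyBeta F u lam x / ENNReal.ofReal lam) *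
          ENNReal.ofReal (y / Uw u y)) * ENNReal.ofReal (y * u y / Uw u y))
        ≤ ENNReal.ofReal (lam / c))


lemma volume_setOf_pos_ofReal_lt (m : ℝ≥0∞) :
    volume {r : ℝ | 0 < r ∧ ENNReal.ofReal r < m} = m := by
  induction m with
  | top =>
    have : {r : ℝ | 0 < r ∧ ENNReal.ofReal r < ⊤} = Ioi 0 := by ext; simp
    rw [this, Real.volume_Ioi]
  | coe m =>
    have : {r : ℝ | 0 < r ∧ ENNReal.ofReal r < m} = Ioo 0 (m : ℝ) := by
      ext r
      simp only [mem_ofPred_eq, mem_Ioo, and_congr_right_iff]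
      intro hr
      rw [← ENNReal.ofReal_coe_nnreal, ENNReal.ofReal_lt_ofReal_iff_of_nonneg hr.le]
    rw [this, Real.volume_Ioo]
    simp

lemma volume_setOf_pos_ofReal_le (m : ℝ≥0∞) :
    volume {r : ℝ | 0 < r ∧ ENNReal.ofReal r ≤ m} = m := by
  induction m with
  | top =>
    have : {r : ℝ | 0 < r ∧ ENNReal.ofReal r ≤ ⊤} = Ioi 0 := by ext; simp
    rw [this, Real.volume_Ioi]
  | coe m =>
    have : {r : ℝ | 0 < r ∧ ENNReal.ofReal r ≤ m} = Ioc 0 (m : ℝ) := by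
      ext r
      simp only [mem_ofPred_eq, mem_Ioc, and_congr_right_iff]
      intro hr
      rw [← ENNReal.ofReal_coe_nnreal, ENNReal.ofReal_le_ofReal_iff m.coe_nonneg]
    rw [this, Real.volume_Ioc]
    simp

section LayerCake

variable {α : Type*} [MeasurableSpace α]

lemma lintegral_volume_slice (ν : Measure α) [SFinite ν] {A : Set (α × ℝ)} (hA : MeasurableSet A) :
    ∫⁻ x, volume ({a | (x, a) ∈ A} ∩ Ioi 0) ∂ν = ∫⁻ a in Ioi (0 : ℝ), ν {x | (x, a) ∈ A} := by
  have h1 := Measure.prod_apply (μ := ν) (ν := volume.restrict (Ioi (0 : ℝ))) hA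
  have h2 := Measure.prod_apply_symm (μ := ν) (ν := volume.restrict (Ioi (0 : ℝ))) hA
  rw [h1] at h2
  simp only [preimage] at h2
  rw [← h2]
  refine lintegral_congr fun x => ?_
  rw [Measure.restrict_apply]
  exact measurable_prodMk_left hA

lemma lintegral_eq_lintegral_measure_lt (ν : Measure α) [SFinite ν] {F : α → ℝ≥0∞}
    (hF : Measurable F) :
    ∫⁻ x, F x ∂ν = ∫⁻ a in Ioi (0 : ℝ), ν {x | ENNReal.ofReal a < F x} := by
  have hA : MeasurableSet {p : α × ℝ | ENNReal.ofReal p.2 < F p.1} :=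
    measurableSet_lt (by fun_prop) (by fun_prop)
  refine Eq.trans (lintegral_congr fun x => ?_) (lintegral_volume_slice ν hA)
  conv_lhs => rw [← volume_setOf_pos_ofReal_lt (F x)]
  congr 1
  ext a
  simp [and_comm]

lemma lintegral_eq_lintegral_measure_le (ν : Measure α) [SFinite ν] {F : α → ℝ≥0∞}
    (hF : Measurable F) :
    ∫⁻ x, F x ∂ν = ∫⁻ a in Ioi (0 : ℝ), ν {x | ENNReal.ofReal a ≤ F x} := by
  have hA : MeasurableSet {p : α × ℝ | ENNReal.ofReal p.2 ≤ F p.1} :=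
    measurableSet_le (by fun_prop) (by fun_prop)
  refine Eq.trans (lintegral_congr fun x => ?_) (lintegral_volume_slice ν hA)
  conv_lhs => rw [← volume_setOf_pos_ofReal_le (F x)]
  congr 1
  ext a
  simp [and_comm]

end LayerCake

section Rearrangement

lemma distrib_antitone (f : ℝ → ℝ≥0∞) : Antitone (distrib f) := fun _ _ h =>
  measure_mono fun _ hx => ⟨hx.1, h.trans_lt hx.2⟩

lemma rearr_antitone (f : ℝ → ℝ≥0∞) : Antitone (rearr f) := fun _ _ h =>
  sInf_le_sInf fun _ hl => le_trans hl (ENNReal.ofReal_le_ofReal h)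

lemma le_rearr_of_lt_distrib {f : ℝ → ℝ≥0∞} {a : ℝ≥0∞} {r : ℝ}
    (h : ENNReal.ofReal r < distrib f a) : a ≤ rearr f r :=
  le_sInf fun _ hl => le_of_not_gt fun hla =>
    (h.trans_le ((distrib_antitone f hla.le).trans hl)).false

lemma rearr_lt_iff {f : ℝ → ℝ≥0∞} {t : ℝ} {a : ℝ≥0∞} {D : Set ℝ≥0∞} (hD : Dense D) :
    rearr f t < a ↔ ∃ q ∈ D, q < a ∧ distrib f q ≤ ENNReal.ofReal t := by
  constructor
  · intro h
    obtain ⟨l, hl, hla⟩ := sInf_lt_iff.1 h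
    obtain ⟨q, hqD, hq⟩ := hD.exists_between hla
    exact ⟨q, hqD, hq.2, (distrib_antitone f hq.1.le).trans hl⟩
  · rintro ⟨q, -, hq, h⟩
    exact lt_of_le_of_lt (sInf_le h) hq

lemma measurable_rearr_slice {J : ℝ → ℝ → ℝ≥0∞} (hJ : Measurable (Function.uncurry J)) :
    Measurable fun p : ℝ × ℝ => rearr (J p.1) p.2 := by
  obtain ⟨D, hDc, hD⟩ := TopologicalSpace.exists_countable_dense ℝ≥0∞
  have hdist (q : ℝ≥0∞) : Measurable fun x => distrib (J x) q := by
    have hA : MeasurableSet {p : ℝ × ℝ | 0 < p.2 ∧ q < Function.uncurry J p} :=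
      (measurableSet_lt measurable_const measurable_snd).inter
        (measurableSet_lt measurable_const hJ)
    exact measurable_measure_prodMk_left hA
  refine measurable_of_Iio fun a => ?_
  have : (fun p : ℝ × ℝ => rearr (J p.1) p.2) ⁻¹' Iio a =
      ⋃ q ∈ D, {p : ℝ × ℝ | q < a ∧ distrib (J p.1) q ≤ ENNReal.ofReal p.2} := by
    ext p
    simp [rearr_lt_iff hD, and_left_comm]
  rw [this]
  refine MeasurableSet.biUnion hDc fun q _ => ?_
  exact (MeasurableSet.const _).inter (measurableSet_le ((hdist q).comp measurable_fst)
    (by fun_prop))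

lemma setLIntegral_le_setLIntegral_rearr {E : Set ℝ} (hE0 : E ⊆ Ioi 0)
    {G : ℝ → ℝ≥0∞} (hG : Measurable G) :
    ∫⁻ x in E, G x ≤ ∫⁻ r in {r : ℝ | 0 < r ∧ ENNReal.ofReal r < volume E}, rearr G r := by
  rw [lintegral_eq_lintegral_measure_lt _ hG,
    lintegral_eq_lintegral_measure_le _ (rearr_antitone G).measurable]
  refine lintegral_mono fun a => ?_
  rw [Measure.restrict_apply (measurableSet_lt measurable_const hG),
    Measure.restrict_apply (measurableSet_le measurable_const (rearr_antitone G).measurable)]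
  calc volume ({x | ENNReal.ofReal a < G x} ∩ E)
      ≤ min (volume E) (distrib G (ENNReal.ofReal a)) :=
        le_min (measure_mono inter_subset_right) (measure_mono fun x hx => ⟨hE0 hx.2, hx.1⟩)
    _ = _ := (volume_setOf_pos_ofReal_lt _).symm
    _ ≤ volume ({r | ENNReal.ofReal a ≤ rearr G r} ∩
          {r | 0 < r ∧ ENNReal.ofReal r < volume E}) := measure_mono fun r hr =>
        ⟨le_rearr_of_lt_distrib (hr.2.trans_le (min_le_right _ _)), hr.1,
          hr.2.trans_le (min_le_left _ _)⟩

/-- The Hardy–Littlewood inequality. -/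
lemma lintegral_mul_le_lintegral_rearr_mul_rearr {F G : ℝ → ℝ≥0∞}
    (hF : Measurable F) (hG : Measurable G) :
    ∫⁻ x in Ioi (0 : ℝ), F x * G x ≤ ∫⁻ r in Ioi (0 : ℝ), rearr F r * rearr G r := by
  have hF' := (rearr_antitone F).measurable
  have hG' := (rearr_antitone G).measurable
  have h1 := lintegral_withDensity_eq_lintegral_mul (volume.restrict (Ioi (0 : ℝ))) hG hF
  have h2 := lintegral_withDensity_eq_lintegral_mul (volume.restrict (Ioi (0 : ℝ))) hG' hF'
  simp only [Pi.mul_apply] at h1 h2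
  simp_rw [mul_comm (F _), mul_comm (rearr F _)]
  rw [← h1, ← h2, lintegral_eq_lintegral_measure_lt _ hF, lintegral_eq_lintegral_measure_le _ hF']
  refine lintegral_mono fun a => ?_
  have hA := measurableSet_lt (measurable_const (a := ENNReal.ofReal a)) hF
  have hB := measurableSet_le (measurable_const (a := ENNReal.ofReal a)) hF'
  rw [withDensity_apply _ hA, withDensity_apply _ hB, Measure.restrict_restrict hA,
    Measure.restrict_restrict hB]
  refine (setLIntegral_le_setLIntegral_rearr inter_subset_right
    hG).trans (lintegral_mono_set fun r hr => ⟨le_rearr_of_lt_distrib ?_, hr.1⟩)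
  refine hr.2.trans_le (measure_mono fun x hx => ⟨hx.2, hx.1⟩)

lemma iterRearr_antitone_left (K : ℝ → ℝ → ℝ≥0∞) (s : ℝ) :
    Antitone fun t => iterRearr K t s := rearr_antitone _

lemma measurable_iterRearr {K : ℝ → ℝ → ℝ≥0∞} (hK : Measurable (Function.uncurry K)) :
    Measurable fun p : ℝ × ℝ => iterRearr K p.1 p.2 := by
  have h : Measurable (Function.uncurry fun s x => rearr (K x) s) :=
    (measurable_rearr_slice hK).comp (measurable_snd.prodMk measurable_fst)
  have h2 := (measurable_rearr_slice h).comp (measurable_snd.prodMk measurable_fst)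
  simpa only [Function.comp_def, iterRearr] using h2

lemma TK_iterRearr_antitone (K : ℝ → ℝ → ℝ≥0∞) (f : ℝ → ℝ≥0∞) :
    Antitone (TK (iterRearr K) f) := fun _ _ h =>
  lintegral_mono fun s => by gcongr; exact iterRearr_antitone_left K s h

lemma measurable_TK {K : ℝ → ℝ → ℝ≥0∞} (hK : Measurable (Function.uncurry K))
    {f : ℝ → ℝ≥0∞} (hf : Measurable f) : Measurable (TK K f) :=
  Measurable.lintegral_prod_right' (f := fun p : ℝ × ℝ => K p.1 p.2 * f p.2)
    (hK.mul (hf.comp measurable_snd))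

lemma setLIntegral_TK_le {K : ℝ → ℝ → ℝ≥0∞} (hK : Measurable (Function.uncurry K))
    {f : ℝ → ℝ≥0∞} (hf : Measurable f) {E : Set ℝ} (hE0 : E ⊆ Ioi 0) :
    ∫⁻ x in E, TK K f x ≤ ∫⁻ r in {r : ℝ | 0 < r ∧ ENNReal.ofReal r < volume E},
      TK (iterRearr K) (rearr f) r := by
  have hk := measurable_rearr_slice hK
  have hf' := (rearr_antitone f).measurable
  calc ∫⁻ x in E, TK K f x
      ≤ ∫⁻ x in E, ∫⁻ s in Ioi (0 : ℝ), rearr (K x) s * rearr f s :=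
        lintegral_mono fun x => lintegral_mul_le_lintegral_rearr_mul_rearr
          (hK.comp measurable_prodMk_left) hf
    _ = ∫⁻ s in Ioi (0 : ℝ), ∫⁻ x in E, rearr (K x) s * rearr f s :=
        lintegral_lintegral_swap (hk.mul (hf'.comp measurable_snd)).aemeasurable
    _ = ∫⁻ s in Ioi (0 : ℝ), (∫⁻ x in E, rearr (K x) s) * rearr f s :=
        lintegral_congr fun s => lintegral_mul_const _ (hk.comp measurable_prodMk_right)
    _ ≤ ∫⁻ s in Ioi (0 : ℝ), (∫⁻ r in {r : ℝ | 0 < r ∧ ENNReal.ofReal r < volume E},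
          iterRearr K r s) * rearr f s := by
        refine lintegral_mono fun s => mul_le_mul_left ?_ _
        exact setLIntegral_le_setLIntegral_rearr hE0 (hk.comp measurable_prodMk_right)
    _ = ∫⁻ s in Ioi (0 : ℝ), ∫⁻ r in {r : ℝ | 0 < r ∧ ENNReal.ofReal r < volume E},
          iterRearr K r s * rearr f s :=
        lintegral_congr fun s => (lintegral_mul_const _
          ((measurable_iterRearr hK).comp measurable_prodMk_right)).symm
    _ = _ := lintegral_lintegral_swap (((measurable_iterRearr hK).comp measurable_swap).mul
          (hf'.comp measurable_fst)).aemeasurable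

end Rearrangement

namespace IsNFunction

variable {F φ : ℝ → ℝ}

lemma map_zero (h : IsNFunction F φ) : F 0 = 0 := by
  simpa using h.2.2.2 0 le_rfl

lemma intervalIntegrable (h : IsNFunction F φ) {a b : ℝ} (ha : 0 ≤ a) (hab : a ≤ b) :
    IntervalIntegrable φ volume a b := by
  have hmono : Monotone fun x => if x ≤ 0 then 0 else φ x := by
    intro x y hxy
    dsimp only
    split_ifs with hx hy hy
    · exact le_rfl
    · exact (h.2.1 (not_le.1 hy)).le
    · exact absurd (hxy.trans hy) hx
    · exact h.1.monotoneOn (not_le.1 hx) (not_le.1 hy) hxy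
  refine (hmono.intervalIntegrable (a := a) (b := b)).congr ?_
  intro x hx
  rw [uIoc_of_le hab] at hx
  exact if_neg (not_le.2 (ha.trans_lt hx.1))

lemma sub_eq_integral (h : IsNFunction F φ) {a b : ℝ} (ha : 0 ≤ a) (hab : a ≤ b) :
    F b - F a = ∫ y in a..b, φ y := by
  rw [h.2.2.2 b (ha.trans hab), h.2.2.2 a ha, intervalIntegral.integral_interval_sub_left
    (h.intervalIntegrable le_rfl (ha.trans hab)) (h.intervalIntegrable le_rfl ha)]

lemma mul_le_sub (h : IsNFunction F φ) {a b : ℝ} (ha : 0 < a) (hab : a ≤ b) :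
    (b - a) * φ a ≤ F b - F a := by
  have := intervalIntegral.integral_mono_on hab intervalIntegrable_const
    (h.intervalIntegrable ha.le hab) (f := fun _ => φ a)
    fun x hx => h.1.monotoneOn ha (ha.trans_le hx.1) hx.1
  simpa [h.sub_eq_integral ha.le hab] using this

lemma le_mul (h : IsNFunction F φ) {a : ℝ} (ha : 0 < a) : F a ≤ a * φ a := by
  have := intervalIntegral.integral_mono_on_of_le_Ioo ha.le
    (h.intervalIntegrable le_rfl ha.le) intervalIntegrable_const (g := fun _ => φ a)
    fun x hx => h.1.monotoneOn hx.1 ha hx.2.le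
  simpa [h.2.2.2 a ha.le] using this

lemma pos (h : IsNFunction F φ) {a : ℝ} (ha : 0 < a) : 0 < F a := by
  have h2 : 0 ≤ F (a / 2) := by
    rw [h.2.2.2 _ (half_pos ha).le]
    refine intervalIntegral.integral_nonneg_of_ae_restrict (half_pos ha).le ?_
    rw [← restrict_Ioc_eq_restrict_Icc]
    exact (ae_restrict_mem measurableSet_Ioc).mono fun x hx => (h.2.1 hx.1).le
  have h3 := h.mul_le_sub (half_pos ha) (half_le_self ha.le)
  have h4 := mul_pos (show 0 < a - a / 2 by linarith) (h.2.1 (half_pos ha))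
  linarith

lemma monotoneOn (h : IsNFunction F φ) : MonotoneOn F (Ici 0) := by
  intro a ha b _ hab
  rcases (mem_Ici.1 ha).eq_or_lt with rfl | ha
  · rcases hab.eq_or_lt with rfl | hb
    · exact le_rfl
    · rw [h.map_zero]
      exact (h.pos hb).le
  · have := h.mul_le_sub ha hab
    have := mul_nonneg (sub_nonneg.2 hab) (h.2.1 ha).le
    linarith

lemma two_mul_half_le (h : IsNFunction F φ) {a : ℝ} (ha : 0 ≤ a) : 2 * F (a / 2) ≤ F a := by
  rcases ha.eq_or_lt with rfl | ha
  · simp [h.map_zero]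
  · have h1 := h.mul_le_sub (half_pos ha) (half_le_self ha.le)
    have h2 := h.le_mul (half_pos ha)
    rw [sub_half] at h1
    linarith

lemma extE_monotone (h : IsNFunction F φ) : Monotone (extE F) := by
  intro a b hab
  unfold extE
  split_ifs with ha hb hb
  · exact le_rfl
  · exact absurd (top_le_iff.1 (ha ▸ hab)) hb
  · exact le_top
  · exact ENNReal.ofReal_le_ofReal (h.monotoneOn ENNReal.toReal_nonneg ENNReal.toReal_nonneg
      (ENNReal.toReal_mono hb hab))

lemma extE_zero (h : IsNFunction F φ) : extE F 0 = 0 := by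
  simp [extE, h.map_zero]

lemma extE_pos (h : IsNFunction F φ) {a : ℝ≥0∞} (ha : a ≠ 0) : 0 < extE F a := by
  unfold extE
  split_ifs with ha'
  · exact ENNReal.zero_lt_top
  · exact ENNReal.ofReal_pos.2 (h.pos (ENNReal.toReal_pos ha ha'))

lemma two_mul_extE_half_le (h : IsNFunction F φ) (a : ℝ≥0∞) :
    2 * extE F (a / 2) ≤ extE F a := by
  by_cases ha : a = ⊤
  · simp [extE, ha]
  · have ha' : a / 2 ≠ ⊤ := ENNReal.div_ne_top ha two_ne_zero
    rw [extE, extE, if_neg ha, if_neg ha', ENNReal.toReal_div, ENNReal.toReal_ofNat,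
      ← ENNReal.ofReal_ofNat, ← ENNReal.ofReal_mul zero_le_two]
    exact ENNReal.ofReal_le_ofReal (h.two_mul_half_le ENNReal.toReal_nonneg)

/-- Young's inequality, in the weak form where `Ψ t` is replaced by `t * ψ t`. -/
lemma mul_ofReal_le_extE_add (h : IsNFunction F φ) {ψ : ℝ → ℝ}
    (hψ : InvOn ψ φ (Ioi 0) (Ioi 0)) (s : ℝ≥0∞) {t : ℝ} (ht : 0 < t) :
    s * ENNReal.ofReal t ≤ extE F s + ENNReal.ofReal (ψ t) * ENNReal.ofReal t := by
  have hψt : 0 < ψ t := by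
    obtain ⟨x, hx, rfl⟩ := h.2.2.1 ht
    rw [hψ.1 hx]
    exact hx
  by_cases hs : s = ⊤
  · simp [extE, hs]
  lift s to NNReal using hs
  rw [extE, if_neg ENNReal.coe_ne_top, ENNReal.coe_toReal, ← ENNReal.ofReal_coe_nnreal,
    ← ENNReal.ofReal_mul s.coe_nonneg, ← ENNReal.ofReal_mul hψt.le]
  rcases le_total (s : ℝ) (ψ t) with hst | hst
  · exact le_add_left (ENNReal.ofReal_le_ofReal (mul_le_mul_of_nonneg_right hst ht.le))
  · have h1 := h.mul_le_sub hψt hst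
    rw [hψ.2 ht] at h1
    have h2 := h.pos hψt
    rw [← ENNReal.ofReal_add (by linarith [mul_nonneg (sub_nonneg.2 hst) ht.le]) (by positivity)]
    exact ENNReal.ofReal_le_ofReal (by linarith)

end IsNFunction

section Gauge

variable {F : ℝ → ℝ} {u : ℝ → ℝ}

lemma ogauge_eq_zero {f : ℝ → ℝ≥0∞}
    (h : ∀ l : ℝ≥0∞, 0 < l → (∫⁻ x in Ioi (0 : ℝ), extE F (f x / l) * ENNReal.ofReal (u x)) = 0) :
    ogauge F u f = 0 := by
  refine le_antisymm (le_of_forall_gt fun l hl => ?_) zero_le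
  obtain ⟨l', hl', h'⟩ := exists_between hl
  exact lt_of_le_of_lt (sInf_le ⟨hl', (h l' hl').trans_le zero_le_one⟩) h'

lemma ogauge_mono {φ : ℝ → ℝ} (hF : IsNFunction F φ) {f g : ℝ → ℝ≥0∞}
    (h : ∀ x, 0 < x → f x ≤ g x) : ogauge F u f ≤ ogauge F u g := by
  refine sInf_le_sInf fun l hl => ⟨hl.1, le_trans (setLIntegral_mono' measurableSet_Ioi
    fun x hx => ?_) hl.2⟩
  gcongr
  exact hF.extE_monotone (ENNReal.div_le_div_right (h x hx) l)

/-- A modular inequality, valid on a cone of functions, implies a gauge inequality. -/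
lemma ogauge_le_mul_of_modular {φ : ℝ → ℝ} (hF : IsNFunction F φ)
    {T : (ℝ → ℝ≥0∞) → ℝ → ℝ≥0∞} {κ : ℝ} (hκ : 0 < κ) {g : ℝ → ℝ≥0∞}
    (hT : ∀ l : ℝ≥0∞, l ≠ ⊤ → ∀ x, 0 < x → T g x * l = T (fun y => g y * l) x)
    (h : ∀ l : ℝ≥0∞, l ≠ ⊤ →
      ∫⁻ x in Ioi (0 : ℝ), extE F (ENNReal.ofReal κ * T (fun y => g y * l) x) *
        ENNReal.ofReal (u x) ≤
      8 * ∫⁻ x in Ioi (0 : ℝ), extE F (g x * l) * ENNReal.ofReal (u x)) :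
    ogauge F u (T g) ≤ ENNReal.ofReal (8 / κ) * ogauge F u g := by
  have hκ' : ENNReal.ofReal κ ≠ 0 := (ENNReal.ofReal_pos.2 hκ).ne'
  have hA0 : ENNReal.ofReal (8 / κ) ≠ 0 := (ENNReal.ofReal_pos.2 (by positivity)).ne'
  rw [mul_comm, ← ENNReal.div_le_iff hA0 ENNReal.ofReal_ne_top]
  refine le_sInf fun l ⟨hl0, hl⟩ => ?_
  rw [ENNReal.div_le_iff hA0 ENNReal.ofReal_ne_top]
  by_cases hlt : l = ⊤
  · rw [hlt, ENNReal.top_mul hA0]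
    exact le_top
  refine sInf_le ⟨ENNReal.mul_pos hl0.ne' hA0, ?_⟩
  have hli : l⁻¹ ≠ ⊤ := ENNReal.inv_ne_top.2 hl0.ne'
  have key := h l⁻¹ hli
  simp only [← div_eq_mul_inv] at key
  have h8 : (8 : ℝ≥0∞) * ∫⁻ x in Ioi (0 : ℝ), extE F (T g x / (l * ENNReal.ofReal (8 / κ))) *
      ENNReal.ofReal (u x) ≤ 8 * 1 := by
    refine le_trans ?_ (key.trans (mul_le_mul_right hl 8))
    rw [← lintegral_const_mul' _ _ (by simp)]
    refine setLIntegral_mono' measurableSet_Ioi fun x hx => ?_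
    rw [← mul_assoc]
    gcongr
    have e : T g x / (l * ENNReal.ofReal (8 / κ)) =
        (ENNReal.ofReal κ * T (fun y => g y / l) x) / 2 / 2 / 2 := by
      have h1 := hT l⁻¹ hli x hx
      simp only [← div_eq_mul_inv] at h1
      rw [← h1]
      simp only [div_eq_mul_inv]
      rw [ENNReal.mul_inv (Or.inl hl0.ne') (Or.inl hlt), ENNReal.ofReal_mul (by norm_num),
        ENNReal.ofReal_inv_of_pos hκ, ENNReal.mul_inv (Or.inl (by simp)) (Or.inl (by simp)),
        inv_inv, ENNReal.ofReal_ofNat, show (8 : ℝ≥0∞) = 2 * 2 * 2 by norm_num,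
        ENNReal.mul_inv (Or.inl (by norm_num)) (Or.inl (by norm_num)),
        ENNReal.mul_inv (Or.inl (by simp)) (Or.inl (by simp))]
      ring
    rw [e]
    set z := ENNReal.ofReal κ * T (fun y => g y / l) x
    calc 8 * extE F (z / 2 / 2 / 2) = 2 * (2 * (2 * extE F (z / 2 / 2 / 2))) := by
          rw [← mul_assoc, ← mul_assoc]; norm_num
      _ ≤ 2 * (2 * extE F (z / 2 / 2)) := by gcongr; exact hF.two_mul_extE_half_le _
      _ ≤ 2 * extE F (z / 2) := by gcongr; exact hF.two_mul_extE_half_le _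
      _ ≤ extE F z := hF.two_mul_extE_half_le _
  exact (ENNReal.mul_le_mul_iff_right (by simp) (by simp)).1 h8

end Gauge

section NullSingleton

variable {ν : Measure ℝ} [NullSingletonClass ν]

lemma measure_setOf_measure_Ioc_le_le (a : ℝ≥0∞) : ν {x | 0 < x ∧ ν (Ioc 0 x) ≤ a} ≤ a := by
  set D : Set ℝ := {x | 0 < x ∧ ν (Ioc 0 x) ≤ a} with hD
  set S : Set ℝ := ⋃ q : {q : ℚ // (q : ℝ) ∈ D}, Ioc 0 (q.1 : ℝ) with hS
  have hS_le : ν S ≤ a := by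
    rw [hS, Directed.measure_iUnion]
    · exact iSup_le fun q => q.2.2
    · intro p q
      rcases le_total (p.1 : ℝ) q.1 with h | h
      · exact ⟨q, Ioc_subset_Ioc_right h, subset_rfl⟩
      · exact ⟨p, subset_rfl, Ioc_subset_Ioc_right h⟩
  have hsub : (D \ S).Subsingleton := by
    have key : ∀ x ∈ D \ S, ∀ y ∈ D \ S, ¬ x < y := by
      intro x hx y hy hxy
      obtain ⟨q, hxq, hqy⟩ := exists_rat_btwn hxy
      refine hx.2 (mem_iUnion.2 ⟨⟨q, hx.1.1.trans hxq, ?_⟩, hx.1.1, hxq.le⟩)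
      exact (measure_mono (Ioc_subset_Ioc_right hqy.le)).trans hy.1.2
    intro x hx y hy
    exact le_antisymm (not_lt.1 (key y hy x hx)) (not_lt.1 (key x hx y hy))
  calc ν D ≤ ν ((D \ S) ∪ S) := measure_mono (by simp)
    _ ≤ ν (D \ S) + ν S := measure_union_le _ _
    _ ≤ a := by rw [hsub.measure_zero ν, zero_add]; exact hS_le

lemma measure_setOf_measure_Ioi_eq_zero : ν {x | ν (Ioi x) = 0} = 0 := by
  set D : Set ℝ := {x | ν (Ioi x) = 0} with hD
  set S : Set ℝ := ⋃ q : {q : ℚ // (q : ℝ) ∈ D}, Ioi (q.1 : ℝ) with hS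
  have hS_zero : ν S = 0 := measure_iUnion_null fun q => q.2
  have hsub : (D \ S).Subsingleton := by
    have key : ∀ x ∈ D \ S, ∀ y ∈ D \ S, ¬ x < y := by
      intro x hx y hy hxy
      obtain ⟨q, hxq, hqy⟩ := exists_rat_btwn hxy
      exact hy.2 (mem_iUnion.2 ⟨⟨q, measure_mono_null (Ioi_subset_Ioi hxq.le) hx.1⟩, hqy⟩)
    intro x hx y hy
    exact le_antisymm (not_lt.1 (key y hy x hx)) (not_lt.1 (key x hx y hy))
  refine measure_mono_null (t := (D \ S) ∪ S) (by simp) ?_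
  exact measure_union_null (hsub.measure_zero ν) hS_zero

lemma exists_measure_Ioc_eq {X : ℝ} (hX : 0 ≤ X) (hfin : ν (Ioc 0 X) ≠ ⊤) {b : ℝ≥0∞}
    (hb : b ≤ ν (Ioc 0 X)) : ∃ q ∈ Icc 0 X, ν (Ioc 0 q) = b := by
  have hfin' : IsFiniteMeasure (ν.restrict (Ioc 0 X)) :=
    isFiniteMeasure_restrict.2 hfin
  have hcont := intervalIntegral.continuous_primitive (μ := ν.restrict (Ioc 0 X))
    (f := fun _ => (1 : ℝ)) (fun _ _ => intervalIntegrable_const) 0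
  have heq : ∀ q ∈ Icc 0 X, ∫ _ in (0 : ℝ)..q, (1 : ℝ) ∂(ν.restrict (Ioc 0 X)) =
      (ν (Ioc 0 q)).toReal := by
    intro q hq
    rw [intervalIntegral.integral_of_le hq.1]
    simp only [integral_const, smul_eq_mul, mul_one, measureReal_def]
    rw [Measure.restrict_restrict measurableSet_Ioc, Measure.restrict_apply_univ,
      inter_eq_left.2 (Ioc_subset_Ioc_right hq.2)]
  obtain ⟨q, hq, hqb⟩ := intermediate_value_Icc hX hcont.continuousOn (show b.toReal ∈ _ by
    rw [heq 0 ⟨le_rfl, hX⟩, heq X ⟨hX, le_rfl⟩]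
    simpa using ENNReal.toReal_mono hfin hb)
  refine ⟨q, hq, ?_⟩
  refine (ENNReal.toReal_eq_toReal_iff' (ne_top_of_le_ne_top hfin
    (measure_mono (Ioc_subset_Ioc_right hq.2))) (ne_top_of_le_ne_top hfin hb)).1
    ((heq q hq).symm.trans hqb)

end NullSingleton

lemma rearr_TK_le {K : ℝ → ℝ → ℝ≥0∞} (hK : Measurable (Function.uncurry K))
    {f : ℝ → ℝ≥0∞} (hf : Measurable f) {t : ℝ} (ht : 0 < t) :
    rearr (TK K f) t ≤
      (∫⁻ s in Ioo 0 t, TK (iterRearr K) (rearr f) s) / ENNReal.ofReal t := by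
  refine le_of_forall_lt fun l hl => ?_
  obtain ⟨l', hl', hl''⟩ := exists_between hl
  refine hl'.trans_le ?_
  have hdist : ENNReal.ofReal t < distrib (TK K f) l' :=
    not_le.1 fun h => (sInf_le (a := l') h).not_gt hl''
  set E : Set ℝ := {x | 0 < x ∧ l' < TK K f x} with hE
  have hEm : MeasurableSet E :=
    measurableSet_Ioi.inter (measurableSet_lt measurable_const (measurable_TK hK hf))
  obtain ⟨X, hX0, hX⟩ : ∃ X, 0 < X ∧ ENNReal.ofReal t < volume.restrict E (Ioc 0 X) := by
    by_contra! hcon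
    have h1 := measure_setOf_measure_Ioc_le_le (ν := volume.restrict E) (ENNReal.ofReal t)
    have h2 : {x | 0 < x ∧ volume.restrict E (Ioc 0 x) ≤ ENNReal.ofReal t} = Ioi 0 :=
      Set.ext fun x => ⟨fun hx => hx.1, fun hx => ⟨hx, hcon x hx⟩⟩
    rw [h2, Measure.restrict_apply measurableSet_Ioi,
      inter_eq_right.2 (show E ⊆ Ioi 0 from fun x hx => hx.1)] at h1
    exact h1.not_gt hdist
  obtain ⟨q, -, hq⟩ := exists_measure_Ioc_eq hX0.le (ν := volume.restrict E)
    (((Measure.restrict_apply_le _ _).trans_lt measure_Ioc_lt_top).ne) hX.le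
  rw [Measure.restrict_apply measurableSet_Ioc] at hq
  have h3 := setLIntegral_TK_le hK hf (E := Ioc 0 q ∩ E) fun x hx => hx.1.1
  rw [hq] at h3
  have h4 : {r : ℝ | 0 < r ∧ ENNReal.ofReal r < ENNReal.ofReal t} = Ioo 0 t := by
    ext r
    simp [ENNReal.ofReal_lt_ofReal_iff ht]
  rw [h4] at h3
  rw [ENNReal.le_div_iff_mul_le (Or.inl (ENNReal.ofReal_pos.2 ht).ne')
    (Or.inl ENNReal.ofReal_ne_top)]
  calc l' * ENNReal.ofReal t = ∫⁻ _ in Ioc 0 q ∩ E, l' := by rw [setLIntegral_const, hq]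
    _ ≤ ∫⁻ x in Ioc 0 q ∩ E, TK K f x :=
        setLIntegral_mono' (measurableSet_Ioc.inter hEm) fun x hx => hx.2.2.le
    _ ≤ _ := h3

section HardyAverage

/-- The factor `y / μ(0,y]` relating averages over `(0,x)` to integrals against `μ`. -/
def avgWeight (μ : Measure ℝ) (y : ℝ) : ℝ≥0∞ := ENNReal.ofReal (y / (μ (Ioc 0 y)).toReal)

/-- `∫_x^∞ Φ(λ/y) dμ(y)`. -/
def tailModular (μ : Measure ℝ) (F : ℝ → ℝ) (lam x : ℝ) : ℝ≥0∞ :=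
  ∫⁻ y in Ioi x, extE F (ENNReal.ofReal (lam / y)) ∂μ

/-- The second Hardy-averaging condition for a measure in place of a weight. -/
def HardyCondition (μ : Measure ℝ) (F ψ : ℝ → ℝ) (c : ℝ) : Prop :=
  ∀ lam > 0, ∀ x > 0, ∫⁻ y in Ioo 0 x,
    extE ψ (ENNReal.ofReal c * tailModular μ F lam x / ENNReal.ofReal lam * avgWeight μ y) *
      avgWeight μ y ∂μ ≤ ENNReal.ofReal (lam / c)

variable {μ : Measure ℝ} {F φ ψ : ℝ → ℝ} {c : ℝ}

lemma measurable_measure_Ioc : Measurable fun y => μ (Ioc 0 y) :=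
  Monotone.measurable fun _ _ h => measure_mono (Ioc_subset_Ioc_right h)

lemma measurable_avgWeight : Measurable (avgWeight μ) :=
  (measurable_id.div measurable_measure_Ioc.ennreal_toReal).ennreal_ofReal

lemma monotoneOn_of_invOn (h : IsNFunction F φ) (hψ : InvOn ψ φ (Ioi 0) (Ioi 0)) :
    MonotoneOn ψ (Ioi 0) := by
  have hpos : ∀ t, 0 < t → 0 < ψ t := by
    intro t ht
    obtain ⟨x, hx, rfl⟩ := h.2.2.1 ht
    rw [hψ.1 hx]
    exact hx
  intro s hs t ht hst
  refine (h.1.le_iff_le (hpos s hs) (hpos t ht)).1 ?_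
  rwa [hψ.2 hs, hψ.2 ht]

/-- Young's inequality combined with the Hardy-averaging condition. -/
lemma HardyCondition.mul_setLIntegral_le [NullSingletonClass μ] (hH : HardyCondition μ F ψ c)
    (hF : IsNFunction F φ) (hψ : InvOn ψ φ (Ioi 0) (Ioi 0)) (hc : 0 < c)
    {lam x b : ℝ} (hlam : 0 < lam) (hx : 0 < x) (hb : 0 < b)
    (hbβ : ENNReal.ofReal b ≤ tailModular μ F lam x) {A : Set ℝ} (hA : MeasurableSet A)
    (hAx : A ⊆ Ioc 0 x) {h : ℝ → ℝ≥0∞} (hh : Measurable h) :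
    ENNReal.ofReal (c * b / lam) * ∫⁻ y in A, h y * avgWeight μ y ∂μ ≤
      ∫⁻ y in A, extE F (h y) ∂μ + ENNReal.ofReal b := by
  set C := ENNReal.ofReal (c * b / lam) with hC
  have hCβ : C ≤ ENNReal.ofReal c * tailModular μ F lam x / ENNReal.ofReal lam := by
    rw [hC, ENNReal.ofReal_div_of_pos hlam, ENNReal.ofReal_mul hc.le]
    gcongr
  set B := ENNReal.ofReal c * tailModular μ F lam x / ENNReal.ofReal lam
  have hpt : ∀ y ∈ A, C * (h y * avgWeight μ y) ≤
      extE F (h y) + C * (extE ψ (B * avgWeight μ y) * avgWeight μ y) := by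
    intro y hy
    rcases le_or_gt (y / (μ (Ioc 0 y)).toReal) 0 with h0 | h0
    · simp [avgWeight, ENNReal.ofReal_of_nonpos h0]
    · have ht : 0 < c * b / lam * (y / (μ (Ioc 0 y)).toReal) := by positivity
      have e : ENNReal.ofReal (c * b / lam * (y / (μ (Ioc 0 y)).toReal)) = C * avgWeight μ y :=
        ENNReal.ofReal_mul (by positivity)
      have h1 := hF.mul_ofReal_le_extE_add hψ (h y) ht
      rw [e] at h1
      have h2 : ENNReal.ofReal (ψ (c * b / lam * (y / (μ (Ioc 0 y)).toReal))) ≤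
          extE ψ (B * avgWeight μ y) := by
        unfold extE
        split_ifs with htop
        · exact le_top
        · refine ENNReal.ofReal_le_ofReal ?_
          have h3 : c * b / lam * (y / (μ (Ioc 0 y)).toReal) ≤ (B * avgWeight μ y).toReal := by
            rw [← ENNReal.ofReal_le_iff_le_toReal htop, e]
            gcongr
          exact monotoneOn_of_invOn hF hψ ht (ht.trans_le h3) h3
      calc C * (h y * avgWeight μ y) = h y * (C * avgWeight μ y) := by ring
        _ ≤ _ := h1
        _ ≤ extE F (h y) + extE ψ (B * avgWeight μ y) * (C * avgWeight μ y) := by gcongr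
        _ = _ := by ring
  calc C * ∫⁻ y in A, h y * avgWeight μ y ∂μ
      = ∫⁻ y in A, C * (h y * avgWeight μ y) ∂μ :=
        (lintegral_const_mul' _ _ ENNReal.ofReal_ne_top).symm
    _ ≤ ∫⁻ y in A, extE F (h y) + C * (extE ψ (B * avgWeight μ y) * avgWeight μ y) ∂μ :=
        setLIntegral_mono' hA hpt
    _ = ∫⁻ y in A, extE F (h y) ∂μ +
          C * ∫⁻ y in A, extE ψ (B * avgWeight μ y) * avgWeight μ y ∂μ := by
        rw [lintegral_add_left (f := fun y => extE F (h y)) (hF.extE_monotone.measurable.comp hh),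
          lintegral_const_mul' _ _ ENNReal.ofReal_ne_top]
    _ ≤ ∫⁻ y in A, extE F (h y) ∂μ + C * ENNReal.ofReal (lam / c) := by
        gcongr
        refine (lintegral_mono_set hAx).trans ?_
        rw [← setLIntegral_congr (Ioo_ae_eq_Ioc (μ := μ))]
        exact hH lam hlam x hx
    _ = _ := by
        rw [hC, ← ENNReal.ofReal_mul (by positivity)]
        congr 2
        field_simp

lemma tailModular_ne_zero (hF : IsNFunction F φ) {lam x : ℝ} (hlam : 0 < lam) (hx : 0 < x)
    (h : μ (Ioi x) ≠ 0) : tailModular μ F lam x ≠ 0 := by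
  intro h0
  have hm : Measurable fun y => extE F (ENNReal.ofReal (lam / y)) :=
    hF.extE_monotone.measurable.comp (measurable_const.div measurable_id).ennreal_ofReal
  rw [tailModular, setLIntegral_eq_zero_iff measurableSet_Ioi hm] at h0
  refine h ?_
  have : ∀ᵐ y ∂μ, y ∉ Ioi x := by
    filter_upwards [h0] with y hy hyx
    refine (hF.extE_pos (ENNReal.ofReal_pos.2 ?_).ne').ne' (hy hyx)
    exact div_pos hlam (hx.trans hyx)
  simpa using measure_eq_zero_iff_ae_notMem.2 this

lemma exists_pos_ofReal_le {a : ℝ≥0∞} (ha : a ≠ 0) : ∃ b : ℝ, 0 < b ∧ ENNReal.ofReal b ≤ a := by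
  obtain ⟨b, hb0, hb⟩ := ENNReal.lt_iff_exists_nnreal_btwn.1 (pos_iff_ne_zero.2 ha)
  exact ⟨b, by exact_mod_cast hb0, by simpa using hb.le⟩

/-- The Hardy-averaging condition bounds the averaging operator with respect to
`avgWeight μ • μ`. -/
lemma HardyCondition.modular_le [NullSingletonClass μ] (hH : HardyCondition μ F ψ c)
    (hF : IsNFunction F φ) (hψ : InvOn ψ φ (Ioi 0) (Ioi 0)) (hc : 0 < c)
    (hμ : μ (Iic 0) = 0) {h : ℝ → ℝ≥0∞} (hh : Measurable h) :
    ∫⁻ x, extE F (ENNReal.ofReal (c / 8) *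
      ((∫⁻ y in Ioc 0 x, h y * avgWeight μ y ∂μ) / ENNReal.ofReal x)) ∂μ ≤
    ∫⁻ x, extE F (h x) ∂μ := by
  set I := ∫⁻ x, extE F (h x) ∂μ with hI
  by_cases hItop : I = ⊤
  · rw [hItop]; exact le_top
  set ν := μ.withDensity (fun y => h y * avgWeight μ y) with hν
  have hHν : ∀ x, ∫⁻ y in Ioc 0 x, h y * avgWeight μ y ∂μ = ν (Ioc 0 x) := fun x =>
    (withDensity_apply _ measurableSet_Ioc).symm
  simp only [hHν]
  set f : ℝ → ℝ≥0∞ := fun x =>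
    extE F (ENNReal.ofReal (c / 8) * (ν (Ioc 0 x) / ENNReal.ofReal x)) with hf
  let A : ℝ≥0∞ → Set ℝ := fun a => {x | 0 < x ∧ a < ν (Ioc 0 x) ∧ ν (Ioc 0 x) ≤ 2 * a}
  have hAm : ∀ a, MeasurableSet (A a) := fun a => measurableSet_Ioi.inter
    ((measurableSet_lt measurable_const measurable_measure_Ioc).inter
      (measurableSet_le measurable_measure_Ioc measurable_const))
  have hstep : ∀ a : ℝ≥0∞, a ≠ 0 → a ≠ ⊤ →
      ∫⁻ x in A (2 * a), f x ∂μ ≤ ∫⁻ x in A a, extE F (h x) ∂μ := by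
    intro a ha0 ha
    rcases (A (2 * a)).eq_empty_or_nonempty with hempty | ⟨X, hX0, hXl, hXu⟩
    · simp [hempty]
    have hXtop : ν (Ioc 0 X) ≠ ⊤ :=
      ne_top_of_le_ne_top (ENNReal.mul_ne_top (by simp) (ENNReal.mul_ne_top (by simp) ha)) hXu
    obtain ⟨q, ⟨hq0, -⟩, hq⟩ := exists_measure_Ioc_eq hX0.le hXtop hXl.le
    have hq0 : 0 < q := by
      refine hq0.lt_of_ne fun h0 => ?_
      rw [← h0, Ioc_self, measure_empty] at hq
      exact mul_ne_zero two_ne_zero ha0 hq.symm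
    have har : 0 < a.toReal := ENNReal.toReal_pos ha0 ha
    have hlam : 0 < c * a.toReal / 2 := by positivity
    have hB : ∫⁻ x in A (2 * a), f x ∂μ ≤ tailModular μ F (c * a.toReal / 2) q := by
      refine (setLIntegral_mono' (hAm _) fun y hy => ?_).trans
        (lintegral_mono_set (t := Ioi q) fun y hy => ?_)
      · refine hF.extE_monotone ?_
        have h4 : ν (Ioc 0 y) ≤ ENNReal.ofReal (4 * a.toReal) := by
          rw [ENNReal.ofReal_mul (by norm_num), ENNReal.ofReal_toReal ha, ENNReal.ofReal_ofNat]
          refine hy.2.2.trans_eq ?_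
          rw [← mul_assoc]
          norm_num
        calc ENNReal.ofReal (c / 8) * (ν (Ioc 0 y) / ENNReal.ofReal y)
            ≤ ENNReal.ofReal (c / 8) * (ENNReal.ofReal (4 * a.toReal) / ENNReal.ofReal y) := by
              gcongr
          _ = _ := by
              rw [← ENNReal.ofReal_div_of_pos hy.1, ← ENNReal.ofReal_mul (by positivity)]
              congr 1
              ring
      · refine mem_Ioi.2 (lt_of_not_ge fun hyq => ?_)
        exact (hy.2.1.trans_le (measure_mono (Ioc_subset_Ioc_right hyq))).ne' hq
    refine ENNReal.le_of_forall_nnreal_lt fun b hb => ?_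
    rcases eq_or_ne b 0 with rfl | hb0
    · simp
    have hbpos : 0 < (b : ℝ) := by positivity
    have hA'm : MeasurableSet {y | y ∈ Ioc 0 q ∧ a < ν (Ioc 0 y)} :=
      measurableSet_Ioc.inter (measurableSet_lt measurable_const measurable_measure_Ioc)
    have hA' : {y | y ∈ Ioc 0 q ∧ a < ν (Ioc 0 y)} ⊆ A a := fun y hy =>
      ⟨hy.1.1, hy.2, hq ▸ measure_mono (Ioc_subset_Ioc_right hy.1.2)⟩
    have hY := hH.mul_setLIntegral_le hF hψ hc hlam hq0 hbpos
      (by simpa using hb.le.trans hB) hA'm (fun y hy => hy.1) hh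
    rw [← withDensity_apply _ hA'm, ← hν] at hY
    have hνA' : a ≤ ν {y | y ∈ Ioc 0 q ∧ a < ν (Ioc 0 y)} := by
      have h1 : a + a ≤ ν {y | y ∈ Ioc 0 q ∧ a < ν (Ioc 0 y)} + a := by
        calc a + a = ν (Ioc 0 q) := by rw [hq, two_mul]
          _ ≤ ν ({y | y ∈ Ioc 0 q ∧ a < ν (Ioc 0 y)} ∪ {y | 0 < y ∧ ν (Ioc 0 y) ≤ a}) :=
              measure_mono fun y hy => by
                rcases lt_or_ge a (ν (Ioc 0 y)) with h | h
                · exact Or.inl ⟨hy, h⟩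
                · exact Or.inr ⟨hy.1, h⟩
          _ ≤ _ := (measure_union_le _ _).trans
              (add_le_add_right (measure_setOf_measure_Ioc_le_le a) _)
      exact (ENNReal.add_le_add_iff_right ha).1 h1
    have h2 : (b : ℝ≥0∞) + b ≤ ∫⁻ x in A a, extE F (h x) ∂μ + b := by
      calc (b : ℝ≥0∞) + b = ENNReal.ofReal (c * b / (c * a.toReal / 2)) * a := by
            conv_rhs => rw [← ENNReal.ofReal_toReal ha]
            rw [← ENNReal.ofReal_mul (by positivity), ← ENNReal.ofReal_coe_nnreal,
              ← ENNReal.ofReal_add (by positivity) (by positivity), ENNReal.toReal_ofReal har.le]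
            congr 1
            field_simp
            ring
        _ ≤ _ := by gcongr
        _ ≤ _ := hY
        _ ≤ _ := by
            rw [ENNReal.ofReal_coe_nnreal]
            gcongr
    exact (ENNReal.add_le_add_iff_right ENNReal.coe_ne_top).1 h2
  have htop : ∀ x, 0 < x → ν (Ioc 0 x) = ⊤ → μ (Ioi x) = 0 := by
    intro x hx hxtop
    by_contra hne
    obtain ⟨b, hb, hbβ⟩ := exists_pos_ofReal_le (tailModular_ne_zero hF one_pos hx hne)
    have hY := hH.mul_setLIntegral_le hF hψ hc one_pos hx hb hbβ measurableSet_Ioc subset_rfl hh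
    rw [hHν, hxtop, ENNReal.mul_top (ENNReal.ofReal_pos.2 (by positivity)).ne', top_le_iff,
      ENNReal.add_eq_top] at hY
    rcases hY with hY | hY
    · exact hItop (top_le_iff.1 (hY ▸ setLIntegral_le_lintegral _ _))
    · exact ENNReal.ofReal_ne_top hY
  let e : ℤ → ℝ≥0∞ := fun k => 2 ^ k
  have he0 : ∀ k, e k ≠ 0 := fun k => (ENNReal.zpow_pos (by simp) (by simp) k).ne'
  have he1 : ∀ k, e k ≠ ⊤ := fun k => (ENNReal.zpow_lt_top (by simp) (by simp) k).ne
  have he2 : ∀ k, 2 * e k = e (k + 1) := fun k => by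
    simp only [e]
    rw [ENNReal.zpow_add (by simp) (by simp), zpow_one, mul_comm]
  have hcover : ∫⁻ x, f x ∂μ ≤ ∫⁻ x in ⋃ k : ℤ, A (2 * e k), f x ∂μ := by
    rw [← lintegral_indicator (MeasurableSet.iUnion fun k => hAm _)]
    refine lintegral_mono_ae ?_
    have hae1 : ∀ᵐ x ∂μ, x ∉ Iic 0 := measure_eq_zero_iff_ae_notMem.1 hμ
    have hae2 := measure_eq_zero_iff_ae_notMem.1 (measure_setOf_measure_Ioi_eq_zero (ν := μ))
    filter_upwards [hae1, hae2] with x hx0 hx1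
    have hx0 : 0 < x := not_le.1 hx0
    rcases eq_or_ne (ν (Ioc 0 x)) 0 with hz | hz
    · simp [hf, hz, hF.extE_zero]
    have hnt : ν (Ioc 0 x) ≠ ⊤ := fun h => hx1 (htop x hx0 h)
    obtain ⟨n, hn⟩ := ENNReal.exists_mem_Ioc_zpow hz hnt (y := 2) (by norm_num) (by simp)
    have hn1 : 2 * e (n - 1) = 2 ^ n := by rw [he2, sub_add_cancel]
    rw [indicator_of_mem]
    refine mem_iUnion.2 ⟨n - 1, hx0, ?_, ?_⟩
    · rw [hn1]; exact hn.1
    · rw [hn1]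
      exact hn.2.trans_eq (he2 n).symm
  have hdisj : Pairwise (Function.onFun Disjoint fun k : ℤ => A (e k)) := by
    have hlt : ∀ j k : ℤ, j < k → Disjoint (A (e j)) (A (e k)) := by
      intro j k hjk
      rw [Set.disjoint_left]
      intro x hx hx'
      have h1 : e (j + 1) ≤ e k := ENNReal.zpow_le_of_le (by norm_num) (by omega)
      rw [← he2] at h1
      exact ((hx.2.2.trans h1).trans_lt hx'.2.1).false
    intro j k hjk
    rcases lt_or_gt_of_ne hjk with h | h
    · exact hlt j k h
    · exact (hlt k j h).symm
  calc ∫⁻ x, f x ∂μ ≤ ∫⁻ x in ⋃ k : ℤ, A (2 * e k), f x ∂μ := hcover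
    _ ≤ ∑' k : ℤ, ∫⁻ x in A (2 * e k), f x ∂μ := lintegral_iUnion_le _ _
    _ ≤ ∑' k : ℤ, ∫⁻ x in A (e k), extE F (h x) ∂μ :=
        ENNReal.tsum_le_tsum fun k => hstep _ (he0 k) (he1 k)
    _ = ∫⁻ x in ⋃ k : ℤ, A (e k), extE F (h x) ∂μ :=
        (lintegral_iUnion (fun k => hAm _) hdisj _).symm
    _ ≤ I := setLIntegral_le_lintegral _ _

/-- The supremum of `g` over the points `s` with `μ(0,s] > μ(0,x]/4`. -/
def quarterSup (μ : Measure ℝ) (g : ℝ → ℝ≥0∞) (x : ℝ) : ℝ≥0∞ :=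
  ⨆ s : {s : ℝ // 0 < s ∧ μ (Ioc 0 x) < 4 * μ (Ioc 0 s)}, g s

lemma quarterSup_antitone (g : ℝ → ℝ≥0∞) : Antitone (quarterSup μ g) := fun _ _ hxy =>
  iSup_mono' fun s => ⟨⟨s, s.2.1, (measure_mono (Ioc_subset_Ioc_right hxy)).trans_lt s.2.2⟩, le_rfl⟩

lemma le_quarterSup (g : ℝ → ℝ≥0∞) {s x : ℝ} (hs : 0 < s)
    (h : μ (Ioc 0 x) < 4 * μ (Ioc 0 s)) : g s ≤ quarterSup μ g x :=
  le_iSup (fun s : {s : ℝ // 0 < s ∧ μ (Ioc 0 x) < 4 * μ (Ioc 0 s)} => g s) ⟨s, hs, h⟩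

lemma le_quarterSup_add [NullSingletonClass μ] (g : ℝ → ℝ≥0∞)
    (hpos : ∀ x, 0 < x → μ (Ioc 0 x) ≠ 0) (hfin : ∀ x, μ (Ioc 0 x) ≠ ⊤)
    {s x : ℝ} (hs : 0 < s) :
    g s ≤ quarterSup μ g x + 2 * ∫⁻ y in Ioc s x, quarterSup μ g y * (μ (Ioc 0 y))⁻¹ ∂μ := by
  rcases lt_or_ge (μ (Ioc 0 x)) (4 * μ (Ioc 0 s)) with h | h
  · exact le_add_right (le_quarterSup g hs h)
  set a := μ (Ioc 0 s) with ha
  have ha0 : a ≠ 0 := hpos s hs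
  have hat : a ≠ ⊤ := hfin s
  have h2a : 2 * a ≤ μ (Ioc 0 x) := le_trans (by gcongr; norm_num) h
  have hx : 0 ≤ x := by
    by_contra hx
    rw [Ioc_eq_empty (fun h => hx h.le), measure_empty, nonpos_iff_eq_zero] at h2a
    exact mul_ne_zero two_ne_zero ha0 h2a
  obtain ⟨q, ⟨hq0, hqx⟩, hq⟩ := exists_measure_Ioc_eq hx (hfin x) h2a
  have hsq : s ≤ q := by
    by_contra hqs
    have : 2 * a ≤ a := hq ▸ measure_mono (Ioc_subset_Ioc_right (not_le.1 hqs).le)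
    rw [two_mul] at this
    exact ha0 (nonpos_iff_eq_zero.1
      ((ENNReal.add_le_add_iff_right hat).1 (this.trans_eq (zero_add a).symm)))
  have hsub : μ (Ioc s q) = a := by
    have h1 : μ (Ioc 0 s) + μ (Ioc s q) = μ (Ioc 0 q) := by
      rw [← measure_union (Ioc_disjoint_Ioc_of_le le_rfl) measurableSet_Ioc,
        Ioc_union_Ioc_eq_Ioc hs.le hsq]
    rw [hq, two_mul, ← ha] at h1
    exact (ENNReal.add_right_inj hat).1 h1
  refine le_add_left ?_
  calc g s = 2 * (g s * (2 * a)⁻¹ * a) := by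
        rw [ENNReal.mul_inv (by simp) (by simp)]
        calc g s = g s * (2 * 2⁻¹) * (a⁻¹ * a) := by
              rw [ENNReal.mul_inv_cancel (by simp) (by simp), ENNReal.inv_mul_cancel ha0 hat]
              simp
          _ = _ := by ring
    _ = 2 * ∫⁻ _ in Ioc s q, g s * (2 * a)⁻¹ ∂μ := by rw [setLIntegral_const, hsub]
    _ ≤ 2 * ∫⁻ y in Ioc s q, quarterSup μ g y * (μ (Ioc 0 y))⁻¹ ∂μ := by
        gcongr 2 * ?_
        refine setLIntegral_mono' measurableSet_Ioc fun y hy => ?_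
        have hy2 : μ (Ioc 0 y) ≤ 2 * a := hq ▸ measure_mono (Ioc_subset_Ioc_right hy.2)
        gcongr
        refine le_quarterSup g hs (hy2.trans_lt ?_)
        exact ENNReal.mul_lt_mul_left ha0 hat (by norm_num)
    _ ≤ _ := by gcongr

lemma setLIntegral_le_quarterSup_add [NullSingletonClass μ] [SFinite μ] (g : ℝ → ℝ≥0∞)
    (hpos : ∀ x, 0 < x → μ (Ioc 0 x) ≠ 0) (hfin : ∀ x, μ (Ioc 0 x) ≠ ⊤) (x : ℝ) :
    ∫⁻ s in Ioo 0 x, g s ≤ quarterSup μ g x * ENNReal.ofReal x +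
      2 * ∫⁻ y in Ioc 0 x, quarterSup μ g y * avgWeight μ y ∂μ := by
  set k : ℝ → ℝ≥0∞ := fun y => quarterSup μ g y * (μ (Ioc 0 y))⁻¹ with hk
  have hkm : Measurable k := (quarterSup_antitone g).measurable.mul measurable_measure_Ioc.inv
  have hm : Measurable (Function.uncurry fun s y => (Ioi s).indicator k y) := by
    have : (Function.uncurry fun s y => (Ioi s).indicator k y) =
        {p : ℝ × ℝ | p.1 < p.2}.indicator (fun p => k p.2) := by
      ext p
      simp [indicator, Function.uncurry]
    rw [this]
    exact (hkm.comp measurable_snd).indicator (measurableSet_lt measurable_fst measurable_snd)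
  calc ∫⁻ s in Ioo 0 x, g s
      ≤ ∫⁻ s in Ioo 0 x, (quarterSup μ g x + 2 * ∫⁻ y in Ioc s x, k y ∂μ) :=
        setLIntegral_mono' measurableSet_Ioo fun s hs => le_quarterSup_add g hpos hfin hs.1
    _ = quarterSup μ g x * ENNReal.ofReal x + 2 * ∫⁻ s in Ioo 0 x, ∫⁻ y in Ioc s x, k y ∂μ := by
        rw [lintegral_add_left measurable_const, setLIntegral_const, Real.volume_Ioo, sub_zero,
          lintegral_const_mul' _ _ (by simp)]
    _ ≤ quarterSup μ g x * ENNReal.ofReal x +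
          2 * ∫⁻ s in Ioo 0 x, ∫⁻ y in Ioc 0 x, (Ioi s).indicator k y ∂μ := by
        gcongr _ + 2 * ?_
        refine setLIntegral_mono' measurableSet_Ioo fun s hs => ?_
        rw [lintegral_indicator measurableSet_Ioi, Measure.restrict_restrict measurableSet_Ioi]
        exact lintegral_mono_set fun y hy => ⟨hy.1, hs.1.trans hy.1, hy.2⟩
    _ ≤ _ := by
        gcongr _ + 2 * ?_
        rw [lintegral_lintegral_swap hm.aemeasurable]
        refine setLIntegral_mono' measurableSet_Ioc fun y hy => ?_
        have h1 : ∀ s, (Ioi s).indicator k y = (Iio y).indicator (fun _ => k y) s := fun s => by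
          simp [indicator]
        simp only [h1]
        rw [lintegral_indicator measurableSet_Iio, setLIntegral_const,
          Measure.restrict_apply measurableSet_Iio]
        calc k y * volume (Iio y ∩ Ioo 0 x) ≤ k y * volume (Ioo 0 y) := by
              gcongr
              exact fun z hz => ⟨hz.2.1, hz.1⟩
          _ = quarterSup μ g y * avgWeight μ y := by
              rw [Real.volume_Ioo, sub_zero, avgWeight, ENNReal.ofReal_div_of_pos
                (ENNReal.toReal_pos (hpos y hy.1) (hfin y)), ENNReal.ofReal_toReal (hfin y), hk,
                div_eq_mul_inv]
              ring

lemma quarterSup_modular_le [NullSingletonClass μ] [SFinite μ] (hF : IsNFunction F φ)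
    {g : ℝ → ℝ≥0∞} (hg : Antitone g) (hμ : μ (Iic 0) = 0)
    (hpos : ∀ x, 0 < x → μ (Ioc 0 x) ≠ 0) (hfin : ∀ x, μ (Ioc 0 x) ≠ ⊤) :
    ∫⁻ x, extE F (quarterSup μ g x) ∂μ ≤ 4 * ∫⁻ x, extE F (g x) ∂μ := by
  have hmg : Measurable fun x => extE F (g x) := hF.extE_monotone.measurable.comp hg.measurable
  have hmh : Measurable fun x => extE F (quarterSup μ g x) :=
    hF.extE_monotone.measurable.comp (quarterSup_antitone g).measurable
  have hle : ∀ x, 0 < x → ∃ q, 0 < q ∧ μ (Ioc 0 x) = 4 * μ (Ioc 0 q) ∧ quarterSup μ g x ≤ g q := by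
    intro x hx
    obtain ⟨q, ⟨hq0, hqx⟩, hq⟩ := exists_measure_Ioc_eq hx.le (hfin x)
      (b := μ (Ioc 0 x) / 4)
      (ENNReal.div_le_of_le_mul (le_mul_of_one_le_right zero_le (by norm_num)))
    have hq' : μ (Ioc 0 x) = 4 * μ (Ioc 0 q) := by
      rw [hq, ENNReal.mul_div_cancel (by simp) (by simp)]
    refine ⟨q, hq0.lt_of_ne fun h0 => hpos x hx (by simp [hq', ← h0]), hq', iSup_le fun s => hg ?_⟩
    by_contra hqs
    refine (s.2.2.trans_le (le_of_le_of_eq ?_ hq'.symm)).false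
    gcongr
    exact (not_le.1 hqs).le
  rw [lintegral_eq_lintegral_measure_lt μ hmh, lintegral_eq_lintegral_measure_lt μ hmg,
    ← lintegral_const_mul' _ _ (by simp)]
  refine lintegral_mono fun a => ?_
  set m := μ {x | ENNReal.ofReal a < extE F (g x)} with hm
  calc μ {x | ENNReal.ofReal a < extE F (quarterSup μ g x)}
      ≤ μ (Iic 0 ∪ {x | 0 < x ∧ μ (Ioc 0 x) ≤ 4 * m}) := measure_mono fun x hx => by
        rcases le_or_gt x 0 with h0 | h0
        · exact Or.inl h0
        · obtain ⟨q, -, hq, hgq⟩ := hle x h0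
          refine Or.inr ⟨h0, hq.trans_le ?_⟩
          exact mul_le_mul_right (measure_mono fun y hy =>
            lt_of_lt_of_le hx (hF.extE_monotone (hgq.trans (hg hy.2)))) 4
    _ ≤ μ (Iic 0) + μ {x | 0 < x ∧ μ (Ioc 0 x) ≤ 4 * m} := measure_union_le _ _
    _ ≤ 4 * m := by
        rw [hμ, zero_add]
        exact measure_setOf_measure_Ioc_le_le _

/-- The Hardy-averaging inequality on nonincreasing functions, in modular form. -/
lemma HardyCondition.modular_average_le [NullSingletonClass μ] [SFinite μ]
    (hH : HardyCondition μ F ψ c) (hF : IsNFunction F φ) (hψ : InvOn ψ φ (Ioi 0) (Ioi 0))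
    (hc : 0 < c) (hμ : μ (Iic 0) = 0) (hpos : ∀ x, 0 < x → μ (Ioc 0 x) ≠ 0)
    (hfin : ∀ x, μ (Ioc 0 x) ≠ ⊤) {g : ℝ → ℝ≥0∞} (hg : Antitone g) :
    ∫⁻ x, extE F (ENNReal.ofReal (min 1 (c / 16) / 2) *
      ((∫⁻ s in Ioo 0 x, g s) / ENNReal.ofReal x)) ∂μ ≤ 8 * ∫⁻ x, extE F (g x) ∂μ := by
  set h := quarterSup μ g with hh
  have hhm : Measurable h := (quarterSup_antitone g).measurable
  set H : ℝ → ℝ≥0∞ := fun x =>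
    (∫⁻ y in Ioc 0 x, h y * avgWeight μ y ∂μ) / ENNReal.ofReal x with hHdef
  have hmax : ∀ a b : ℝ≥0∞, extE F (max a b) ≤ extE F a + extE F b := fun a b => by
    rcases le_total a b with hab | hab
    · rw [max_eq_right hab]; exact le_add_left le_rfl
    · rw [max_eq_left hab]; exact le_add_right le_rfl
  have hpt : ∀ x, 0 < x → ENNReal.ofReal (min 1 (c / 16) / 2) *
      ((∫⁻ s in Ioo 0 x, g s) / ENNReal.ofReal x) ≤ max (h x) (ENNReal.ofReal (c / 8) * H x) := by
    intro x hx
    have hx0 : ENNReal.ofReal x ≠ 0 := (ENNReal.ofReal_pos.2 hx).ne'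
    have h1 : (∫⁻ s in Ioo 0 x, g s) / ENNReal.ofReal x ≤ h x + 2 * H x := by
      refine (ENNReal.div_le_div_right (setLIntegral_le_quarterSup_add g hpos hfin x) _).trans_eq ?_
      rw [ENNReal.add_div, ENNReal.mul_div_cancel_right hx0 ENNReal.ofReal_ne_top, mul_div_assoc]
    calc _ ≤ ENNReal.ofReal (min 1 (c / 16) / 2) * (h x + 2 * H x) := by gcongr
      _ = (ENNReal.ofReal (min 1 (c / 16)) * h x +
            ENNReal.ofReal (min 1 (c / 16)) * 2 * H x) / 2 := by
          rw [ENNReal.ofReal_div_of_pos two_pos, ENNReal.ofReal_ofNat]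
          simp only [div_eq_mul_inv]
          ring
      _ ≤ (max (h x) (ENNReal.ofReal (c / 8) * H x) +
            max (h x) (ENNReal.ofReal (c / 8) * H x)) / 2 := by
          gcongr
          · refine le_max_of_le_left (mul_le_of_le_one_left zero_le ?_)
            exact ENNReal.ofReal_le_one.2 (min_le_left _ _)
          · refine le_max_of_le_right ?_
            gcongr
            rw [← ENNReal.ofReal_ofNat, ← ENNReal.ofReal_mul (by positivity)]
            refine ENNReal.ofReal_le_ofReal ?_
            linarith [min_le_right 1 (c / 16)]
      _ = _ := by rw [ENNReal.add_div, ENNReal.add_halves]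
  have hD := quarterSup_modular_le hF hg hμ hpos hfin
  calc _ ≤ ∫⁻ x, extE F (h x) + extE F (ENNReal.ofReal (c / 8) * H x) ∂μ := by
        refine lintegral_mono_ae ?_
        filter_upwards [measure_eq_zero_iff_ae_notMem.1 hμ] with x hx
        exact (hF.extE_monotone (hpt x (not_le.1 hx))).trans (hmax _ _)
    _ = ∫⁻ x, extE F (h x) ∂μ + ∫⁻ x, extE F (ENNReal.ofReal (c / 8) * H x) ∂μ :=
        lintegral_add_left (hF.extE_monotone.measurable.comp hhm) _
    _ ≤ ∫⁻ x, extE F (h x) ∂μ + ∫⁻ x, extE F (h x) ∂μ := by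
        gcongr 1
        exact hH.modular_le hF hψ hc hμ hhm
    _ ≤ 4 * ∫⁻ x, extE F (g x) ∂μ + 4 * ∫⁻ x, extE F (g x) ∂μ := by gcongr
    _ = _ := by rw [← add_mul]; norm_num

/-- The Hardy-averaging condition forces `μ(0,a]` to be positive unless `μ` vanishes. -/
lemma HardyCondition.measure_Ioc_ne_zero [NullSingletonClass μ] (hH : HardyCondition μ F ψ c)
    (hF : IsNFunction F φ) (hψ : InvOn ψ φ (Ioi 0) (Ioi 0)) (hc : 0 < c)
    (hfin : ∀ x, μ (Ioc 0 x) ≠ ⊤) (hμ : μ (Ioi 0) ≠ 0) {a : ℝ} (ha : 0 < a) :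
    μ (Ioc 0 a) ≠ 0 := by
  intro hMa
  obtain ⟨X, hX⟩ : ∃ X : ℝ, μ (Ioc 0 X) ≠ 0 := by
    by_contra! hall
    refine hμ (measure_mono_null (fun x hx => ?_) (measure_iUnion_null fun n : ℕ => hall n))
    obtain ⟨n, hn⟩ := exists_nat_ge x
    exact mem_iUnion.2 ⟨n, hx, hn⟩
  have hX0 : 0 ≤ X := le_of_not_gt fun h => hX (by
    simp [Ioc_eq_empty (fun h' => (h'.trans h).false)])
  obtain ⟨x, ⟨hx0, hxX⟩, hx⟩ := exists_measure_Ioc_eq hX0 (hfin X)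
    (b := μ (Ioc 0 X) / 2) ENNReal.half_le_self
  have hMx : μ (Ioc 0 x) ≠ 0 := hx ▸ (ENNReal.half_pos hX).ne'
  have hx0 : 0 < x := hx0.lt_of_ne fun h => hMx (by simp [← h])
  have htail : μ (Ioi x) ≠ 0 := by
    intro h0
    have : μ (Ioc 0 X) ≤ μ (Ioc 0 x) := by
      calc μ (Ioc 0 X) ≤ μ (Ioc 0 x ∪ Ioi x) := measure_mono fun y hy =>
            (le_or_gt y x).imp (fun h => ⟨hy.1, h⟩) id
        _ ≤ _ := (measure_union_le _ _).trans_eq (by rw [h0, add_zero])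
    rw [hx] at this
    exact (ENNReal.half_lt_self hX (hfin X)).not_ge this
  obtain ⟨b, hb, hbβ⟩ := exists_pos_ofReal_le (tailModular_ne_zero hF one_pos hx0 htail)
  have hY := hH.mul_setLIntegral_le hF hψ hc one_pos hx0 hb hbβ measurableSet_Ioc subset_rfl
    (h := fun _ => 1) measurable_const
  simp only [one_mul, setLIntegral_const] at hY
  have hJ : ∫⁻ y in Ioc 0 x, avgWeight μ y ∂μ ≠ ⊤ := by
    intro h
    rw [h, ENNReal.mul_top (ENNReal.ofReal_pos.2 (by positivity)).ne', top_le_iff] at hY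
    refine ENNReal.add_ne_top.2 ⟨ENNReal.mul_ne_top ?_ (hfin x), ENNReal.ofReal_ne_top⟩ hY
    simp [extE]
  obtain ⟨δ, hδ, hδ'⟩ := exists_pos_setLIntegral_lt_of_measure_lt hJ
    (ENNReal.ofReal_pos.2 ha).ne'
  obtain ⟨d, hd0, hd⟩ := exists_between (lt_min hδ (pos_iff_ne_zero.2 hMx))
  obtain ⟨s, ⟨hs0, hsx⟩, hs⟩ := exists_measure_Ioc_eq hx0.le (hfin x)
    (hd.le.trans (min_le_right _ _))
  have hlt := hδ' (Ioc 0 s) (by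
    rw [Measure.restrict_apply measurableSet_Ioc]
    exact (measure_mono inter_subset_left).trans_lt (hs.trans_lt (hd.trans_le (min_le_left _ _))))
  rw [Measure.restrict_restrict measurableSet_Ioc,
    inter_eq_left.2 (Ioc_subset_Ioc_right hsx)] at hlt
  refine hlt.not_ge ?_
  have hsr : 0 < (μ (Ioc 0 s)).toReal := ENNReal.toReal_pos (hs ▸ hd0.ne') (hfin s)
  calc ENNReal.ofReal a = ENNReal.ofReal (a / (μ (Ioc 0 s)).toReal) * μ (Ioc 0 s) := by
        conv_rhs => rw [← ENNReal.ofReal_toReal (hfin s)]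
        rw [← ENNReal.ofReal_mul (by positivity), ENNReal.toReal_ofReal hsr.le]
        congr 1
        field_simp
    _ = ∫⁻ _ in Ioc 0 s, ENNReal.ofReal (a / (μ (Ioc 0 s)).toReal) ∂μ := by
        rw [setLIntegral_const]
    _ ≤ ∫⁻ y in Ioc 0 s, avgWeight μ y ∂μ := by
        refine setLIntegral_mono_ae measurable_avgWeight.aemeasurable ?_
        have hz : μ {y | 0 < y ∧ μ (Ioc 0 y) ≤ 0} = 0 :=
          nonpos_iff_eq_zero.1 (measure_setOf_measure_Ioc_le_le 0)
        filter_upwards [measure_eq_zero_iff_ae_notMem.1 hz] with y hy hys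
        have hy0 : 0 < μ (Ioc 0 y) := not_le.1 fun h => hy ⟨hys.1, h⟩
        have hay : a ≤ y := le_of_not_gt fun h => hy0.ne'
          (measure_mono_null (Ioc_subset_Ioc_right h.le) hMa)
        have hyr : 0 < (μ (Ioc 0 y)).toReal := ENNReal.toReal_pos hy0.ne' (hfin y)
        refine ENNReal.ofReal_le_ofReal (div_le_div₀ (ha.le.trans hay) hay hyr ?_)
        exact ENNReal.toReal_mono (hfin s) (measure_mono (Ioc_subset_Ioc_right hys.2))

end HardyAverage

section Weight

variable {F φ ψ u : ℝ → ℝ}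

/-- The measure `u(x) dx` on `ℝ₊`. -/
def weightMeasure (u : ℝ → ℝ) : Measure ℝ :=
  (volume.restrict (Ioi 0)).withDensity fun x => ENNReal.ofReal (u x)

instance : SFinite (weightMeasure u) := by
  unfold weightMeasure
  infer_instance

instance : NullSingletonClass (weightMeasure u) := by
  unfold weightMeasure
  infer_instance

lemma setLIntegral_weightMeasure (hu : Measurable u) (f : ℝ → ℝ≥0∞) {s : Set ℝ}
    (hs : MeasurableSet s) (hs0 : s ⊆ Ioi 0) :
    ∫⁻ x in s, f x ∂weightMeasure u = ∫⁻ x in s, f x * ENNReal.ofReal (u x) := by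
  rw [weightMeasure, setLIntegral_withDensity_eq_setLIntegral_mul_non_measurable _
    hu.ennreal_ofReal f hs (ae_of_all _ fun _ => ENNReal.ofReal_lt_top),
    Measure.restrict_restrict hs, inter_eq_left.2 hs0]
  simp only [Pi.mul_apply, mul_comm]

lemma weightMeasure_Iic_zero : weightMeasure u (Iic 0) = 0 := by
  rw [weightMeasure, withDensity_apply _ measurableSet_Iic,
    Measure.restrict_restrict measurableSet_Iic, Iic_inter_Ioi, Ioc_self]
  simp

lemma lintegral_weightMeasure (hu : Measurable u) (f : ℝ → ℝ≥0∞) :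
    ∫⁻ x, f x ∂weightMeasure u = ∫⁻ x in Ioi 0, f x * ENNReal.ofReal (u x) := by
  rw [← setLIntegral_weightMeasure hu f measurableSet_Ioi subset_rfl,
    Measure.restrict_eq_self_of_ae_mem]
  filter_upwards [measure_eq_zero_iff_ae_notMem.1 weightMeasure_Iic_zero] with x hx
  simpa using hx

lemma weightMeasure_apply (hu : Measurable u) {s : Set ℝ} (hs : MeasurableSet s)
    (hs0 : s ⊆ Ioi 0) : weightMeasure u s = ∫⁻ x in s, ENNReal.ofReal (u x) := by
  rw [← setLIntegral_one, setLIntegral_weightMeasure hu _ hs hs0]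
  simp only [one_mul]

lemma Uw_eq_toReal (hu : IsWeight u) {x : ℝ} (hx : 0 ≤ x) :
    Uw u x = (weightMeasure u (Ioc 0 x)).toReal := by
  rw [Uw, intervalIntegral.integral_of_le hx, integral_eq_lintegral_of_nonneg_ae
    (ae_of_all _ hu.2.1) hu.1.aestronglyMeasurable,
    weightMeasure_apply hu.1 measurableSet_Ioc fun y hy => hy.1]

lemma hardyBeta_eq_tailModular (hu : IsWeight u) (lam : ℝ) (hlam : 0 < lam) {x : ℝ} (hx : 0 < x) :
    hardyBeta F u lam x = tailModular (weightMeasure u) F lam x := by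
  rw [hardyBeta, tailModular, setLIntegral_weightMeasure hu.1 _ measurableSet_Ioi
    (Ioi_subset_Ioi hx.le)]
  refine setLIntegral_congr_fun measurableSet_Ioi fun y hy => ?_
  have hy0 : 0 < y := hx.trans hy
  rw [extE, if_neg ENNReal.ofReal_ne_top, ENNReal.toReal_ofReal (div_pos hlam hy0).le]

lemma HardyConditions.exists_hardyCondition (hu : IsWeight u) (h : HardyConditions F φ ψ u) :
    ∃ c > 0, HardyCondition (weightMeasure u) F ψ c := by
  obtain ⟨c, hc, -, h⟩ := h
  refine ⟨c, hc, fun lam hlam x hx => le_of_eq_of_le ?_ (h lam hlam x hx)⟩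
  rw [setLIntegral_weightMeasure hu.1 _ measurableSet_Ioo fun y hy => hy.1]
  refine setLIntegral_congr_fun measurableSet_Ioo fun y hy => ?_
  have hy0 : 0 ≤ y := hy.1.le
  have hU : 0 ≤ y / Uw u y := by
    rw [Uw_eq_toReal hu hy0]
    positivity
  have e : avgWeight (weightMeasure u) y = ENNReal.ofReal (y / Uw u y) := by
    rw [avgWeight, Uw_eq_toReal hu hy0]
  rw [e, hardyBeta_eq_tailModular hu lam hlam hx, mul_assoc, ← ENNReal.ofReal_mul hU,
    div_mul_eq_mul_div]

lemma weightMeasure_Ioc_eq_top (hu : IsWeight u) {x : ℝ} (hx : weightMeasure u (Ioc 0 x) = ⊤)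
    {z : ℝ} (hz : 0 < z) : weightMeasure u (Ioc 0 z) = ⊤ := by
  have h1 : weightMeasure u (Icc z x) ≠ ⊤ := by
    rw [weightMeasure_apply hu.1 measurableSet_Icc fun y hy => hz.trans_le hy.1]
    exact ((hu.2.2.integrableOn_compact_subset (fun y hy => hz.trans_le hy.1)
      isCompact_Icc).lintegral_lt_top).ne
  have h2 : weightMeasure u (Ioc 0 x) ≤ weightMeasure u (Ioc 0 z) + weightMeasure u (Icc z x) :=
    (measure_mono fun y hy => (le_total y z).imp (fun h => ⟨hy.1, h⟩) fun h => ⟨h, hy.2⟩).trans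
      (measure_union_le _ _)
  rw [hx, top_le_iff, ENNReal.add_eq_top] at h2
  exact h2.resolve_right h1

/-- If `u` is not integrable at `0`, a nonincreasing function has infinite gauge unless it
vanishes. -/
lemma ogauge_eq_top_of_antitone (hF : IsNFunction F φ) (hu : IsWeight u)
    {g : ℝ → ℝ≥0∞} (hg : Antitone g) {z : ℝ} (htop : weightMeasure u (Ioc 0 z) = ⊤)
    (hgz : g z ≠ 0) : ogauge F u g = ⊤ := by
  refine top_le_iff.1 (le_sInf fun l ⟨_, hl⟩ => ?_)
  by_contra hlt
  have hlt : l ≠ ⊤ := fun h => hlt h.ge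
  refine (hl.trans_lt ENNReal.one_lt_top).ne (top_le_iff.1 ?_)
  calc ⊤ = extE F (g z / l) * weightMeasure u (Ioc 0 z) := by
        rw [htop, ENNReal.mul_top (hF.extE_pos (ENNReal.div_pos hgz hlt).ne').ne']
    _ = ∫⁻ _ in Ioc 0 z, extE F (g z / l) ∂weightMeasure u := by rw [setLIntegral_const]
    _ ≤ ∫⁻ x in Ioc 0 z, extE F (g x / l) ∂weightMeasure u :=
        setLIntegral_mono' measurableSet_Ioc fun x hx =>
          hF.extE_monotone (ENNReal.div_le_div_right (hg hx.2) l)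
    _ ≤ ∫⁻ x, extE F (g x / l) ∂weightMeasure u := setLIntegral_le_lintegral _ _
    _ = _ := lintegral_weightMeasure hu.1 _

/-- The Hardy-averaging inequality for the gauge of nonincreasing functions. -/
theorem HardyConditions.ogauge_average_le (hH : HardyConditions F φ ψ u) (hF : IsNFunction F φ)
    (hψ : InvOn ψ φ (Ioi 0) (Ioi 0)) (hu : IsWeight u) :
    ∃ A > 0, ∀ g : ℝ → ℝ≥0∞, Antitone g →
      ogauge F u (fun x => (∫⁻ s in Ioo 0 x, g s) / ENNReal.ofReal x) ≤
        ENNReal.ofReal A * ogauge F u g := by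
  by_cases h0 : weightMeasure u (Ioi 0) = 0
  · refine ⟨1, one_pos, fun g _ => le_of_eq_of_le (ogauge_eq_zero fun l _ => ?_) zero_le⟩
    rw [← setLIntegral_weightMeasure hu.1 _ measurableSet_Ioi subset_rfl]
    exact setLIntegral_measure_zero _ _ h0
  by_cases hfin : ∀ x, weightMeasure u (Ioc 0 x) ≠ ⊤
  · obtain ⟨c, hc, hH⟩ := hH.exists_hardyCondition hu
    have hκ : 0 < min 1 (c / 16) / 2 := by positivity
    refine ⟨8 / (min 1 (c / 16) / 2), by positivity, fun g hg => ?_⟩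
    refine ogauge_le_mul_of_modular hF hκ
      (T := fun g x => (∫⁻ s in Ioo 0 x, g s) / ENNReal.ofReal x) ?_ fun l hl => ?_
    · intro l hl x _
      dsimp only
      rw [lintegral_mul_const' _ _ hl, ENNReal.mul_div_right_comm]
    · rw [← lintegral_weightMeasure hu.1, ← lintegral_weightMeasure hu.1]
      exact hH.modular_average_le hF hψ hc weightMeasure_Iic_zero
        (fun x hx => hH.measure_Ioc_ne_zero hF hψ hc hfin h0 hx) hfin
        fun x y hxy => mul_le_mul_left (hg hxy) l
  · push Not at hfin
    obtain ⟨X, hX⟩ := hfin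
    refine ⟨1, one_pos, fun g hg => ?_⟩
    by_cases hz : ∃ z > 0, g z ≠ 0
    · obtain ⟨z, hz0, hz⟩ := hz
      rw [ogauge_eq_top_of_antitone hF hu hg (weightMeasure_Ioc_eq_top hu hX hz0) hz]
      simp
    · push Not at hz
      refine le_of_eq_of_le (ogauge_eq_zero fun l _ => ?_) zero_le
      have : ∀ x, ∫⁻ s in Ioo 0 x, g s = 0 := fun x =>
        (setLIntegral_congr_fun measurableSet_Ioo fun s hs => hz s hs.1).trans lintegral_zero
      simp [this, hF.extE_zero]

end Weight

theorem statement5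
    (K : ℝ → ℝ → ℝ≥0∞) (hK : Measurable (Function.uncurry K))
    (Φ₁ φ₁ Φ₂ φ₂ ψ₁ : ℝ → ℝ)
    (hΦ₁ : IsNFunction Φ₁ φ₁) (hΦ₂ : IsNFunction Φ₂ φ₂)
    (hψ₁ : InvOn ψ₁ φ₁ (Ioi 0) (Ioi 0))
    (u₁ u₂ : ℝ → ℝ) (hu₁ : IsWeight u₁) (hu₂ : IsWeight u₂)
    (hHardy : HardyConditions Φ₁ φ₁ ψ₁ u₁)
    (hmain : ∃ C > 0, ∀ f : ℝ → ℝ≥0∞, Measurable f →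
      ogauge Φ₁ u₁ (TK (iterRearr K) (rearr f)) ≤
        ENNReal.ofReal C * ogauge Φ₂ u₂ (rearr f)) :
    ∃ C > 0, ∀ f : ℝ → ℝ≥0∞, Measurable f →
      ogauge Φ₁ u₁ (rearr (TK K f)) ≤ ENNReal.ofReal C * ogauge Φ₂ u₂ (rearr f) := by
  obtain ⟨C, hC, hmain⟩ := hmain
  obtain ⟨A, hA, hA'⟩ := hHardy.ogauge_average_le hΦ₁ hψ₁ hu₁
  refine ⟨A * C, mul_pos hA hC, fun f hf => ?_⟩
  calc ogauge Φ₁ u₁ (rearr (TK K f))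
      ≤ ogauge Φ₁ u₁ fun t =>
          (∫⁻ s in Ioo 0 t, TK (iterRearr K) (rearr f) s) / ENNReal.ofReal t :=
        ogauge_mono hΦ₁ fun t ht => rearr_TK_le hK hf ht
    _ ≤ ENNReal.ofReal A * ogauge Φ₁ u₁ (TK (iterRearr K) (rearr f)) :=
        hA' _ (TK_iterRearr_antitone K (rearr f))
    _ ≤ ENNReal.ofReal A * (ENNReal.ofReal C * ogauge Φ₂ u₂ (rearr f)) := by
        gcongr
        exact hmain f hf
    _ = _ := by rw [ENNReal.ofReal_mul hA.le, mul_assoc]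

end
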